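/- Let N > 2 be an integer, p ≥ 1 a real number, and u, H : ℝ^N → ℝ continuously differentiable. Set h := |H|^{p−1}H, s' := 2N/(N+2), Ψ₂(y) := M(|H|^{2(p−1)}|DH|²)(y), and Ψ₃(y) := M((|H|^p |Du|)^{s'})(y). Then there exists a constant C depending only on N and p such that for every y ∈ ℝ^N, sup_{ε>0} ∫_{B_ε(y)} |Dφ_ε(x−y)| · |h(x) − h_{B_ε(y)}| · |h(x)| · |Du(x)| dx ≤ C · Ψ₂(y)^{1/2} · Ψ₃(y)^{1/s'}. -/

import Mathlib

open MeasureTheory Metric ENNReal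
open scoped ENNReal Topology

noncomputable section

abbrev Euc (N : ℕ) := EuclideanSpace ℝ (Fin N)

/-- Centered Hardy–Littlewood maximal function. -/
def maxFn {N : ℕ} (F : Euc N → ℝ) (y : Euc N) : ℝ≥0∞ :=
  ⨆ (ε : ℝ) (_ : 0 < ε),
    (∫⁻ x in ball y ε, ENNReal.ofReal |F x| ∂volume) / volume (ball y ε)

/-- The rescaled mollifier `φ_ε(x) = ε^{-N} φ(x/ε)`. -/
def molli {N : ℕ} (φ : Euc N → ℝ) (ε : ℝ) (x : Euc N) : ℝ :=
  ε ^ (-(N : ℝ)) * φ (ε⁻¹ • x)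

/-- `G(y) = sup_{ε>0} ∫_{B_ε(y)} |Dφ_ε(x-y)| |h(x)-h_{B_ε(y)}| (|h(x)|+|h_{B_ε(y)}|) |Du(x)| dx`. -/
def Gfun {N : ℕ} (φ u h : Euc N → ℝ) (y : Euc N) : ℝ≥0∞ :=
  ⨆ (ε : ℝ) (_ : 0 < ε),
    ∫⁻ x in ball y ε, ENNReal.ofReal
      (‖gradient (molli φ ε) (x - y)‖ *
        |h x - ⨍ z in ball y ε, h z ∂volume| *
        (|h x| + |⨍ z in ball y ε, h z ∂volume|) * ‖gradient u x‖) ∂volume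

lemma setLIntegral_comp_homothety_le {N : ℕ} {S : Set (Euc N)} (hS : Convex ℝ S)
    (hSm : MeasurableSet S) {G : Euc N → ℝ≥0∞} (hG : Measurable G) {t : ℝ} (ht : 1 / 2 ≤ t)
    (ht1 : t ≤ 1) {z : Euc N} (hz : z ∈ S) :
    ∫⁻ x in S, G (z + t • (x - z)) ≤ 2 ^ N * ∫⁻ x in S, G x := by
  have ht0 : 0 < t := by linarith
  have hmeas : Measurable (S.indicator G) := hG.indicator hSm
  have hscale : ENNReal.ofReal |(t ^ N)⁻¹| ≤ 2 ^ N := by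
    rw [abs_of_pos (by positivity), ← inv_pow, ENNReal.ofReal_pow (by positivity)]
    gcongr
    rw [← ENNReal.ofReal_ofNat]
    refine ENNReal.ofReal_le_ofReal ?_
    rw [inv_le_comm₀ ht0 (by norm_num)]
    linarith
  calc ∫⁻ x in S, G (z + t • (x - z))
      ≤ ∫⁻ x, S.indicator G ((z - t • z) + t • x) := by
        rw [← lintegral_indicator hSm]
        refine lintegral_mono fun x => ?_
        by_cases hx : x ∉ S
        · simp [hx]
        rw [not_not] at hx
        have hmem : z + t • (x - z) ∈ S := hS.add_smul_sub_mem hz hx ⟨ht0.le, ht1⟩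
        have heq : z - t • z + t • x = z + t • (x - z) := by rw [smul_sub]; abel
        rw [heq, Set.indicator_of_mem hmem, Set.indicator_of_mem hx]
    _ = ∫⁻ w, S.indicator G ((z - t • z) + w) ∂(Measure.map (t • ·) volume) := by
        rw [lintegral_map (f := fun w => S.indicator G ((z - t • z) + w))
          (hmeas.comp (measurable_const_add _)) (measurable_const_smul t)]
    _ = ENNReal.ofReal |(t ^ N)⁻¹| * ∫⁻ x in S, G x := by
        rw [Measure.map_addHaar_smul _ ht0.ne', lintegral_smul_measure,
          lintegral_add_left_eq_self, lintegral_indicator hSm]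
        simp
    _ ≤ 2 ^ N * ∫⁻ x in S, G x := by gcongr

lemma setLIntegral_setLIntegral_segment_le {N : ℕ} {S : Set (Euc N)} (hS : Convex ℝ S)
    (hSm : MeasurableSet S) {G : Euc N → ℝ≥0∞} (hG : Measurable G) {t : ℝ} (ht0 : 0 ≤ t)
    (ht1 : t ≤ 1) :
    ∫⁻ z in S, ∫⁻ x in S, G (z + t • (x - z)) ≤ 2 ^ N * volume S * ∫⁻ x in S, G x := by
  suffices key : ∀ s : ℝ, 1 / 2 ≤ s → s ≤ 1 →
      ∫⁻ z in S, ∫⁻ x in S, G (z + s • (x - z)) ≤ 2 ^ N * volume S * ∫⁻ x in S, G x by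
    rcases le_total (1 / 2) t with h | h
    · exact key t h ht1
    · rw [lintegral_lintegral_swap (by fun_prop)]
      convert key (1 - t) (by linarith) (by linarith) using 6 with x z
      module
  intro s hs hs1
  calc ∫⁻ z in S, ∫⁻ x in S, G (z + s • (x - z))
      ≤ ∫⁻ _ in S, 2 ^ N * ∫⁻ x in S, G x :=
        setLIntegral_mono' hSm fun z hz => setLIntegral_comp_homothety_le hS hSm hG hs hs1 hz
    _ = 2 ^ N * volume S * ∫⁻ x in S, G x := by
        rw [setLIntegral_const]; ring

lemma sq_lintegral_le_lintegral_sq {α : Type*} [MeasurableSpace α] {μ : Measure α}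
    [IsProbabilityMeasure μ] {f : α → ℝ≥0∞} (hf : AEMeasurable f μ) :
    (∫⁻ a, f a ∂μ) ^ 2 ≤ ∫⁻ a, f a ^ 2 ∂μ := by
  have h := ENNReal.lintegral_mul_le_Lp_mul_Lq μ Real.HolderConjugate.two_two hf
    (aemeasurable_const (b := (1 : ℝ≥0∞)))
  simp only [Pi.mul_apply, mul_one, ENNReal.one_rpow, lintegral_const, measure_univ,
    ENNReal.rpow_two, one_pow] at h
  calc (∫⁻ a, f a ∂μ) ^ 2 ≤ ((∫⁻ a, f a ^ 2 ∂μ) ^ ((1 : ℝ) / 2)) ^ 2 := by gcongr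
    _ = ∫⁻ a, f a ^ 2 ∂μ := by
      rw [← ENNReal.rpow_two, ← ENNReal.rpow_mul]; norm_num

lemma enorm_sub_sq_le_lintegral_fderiv {E : Type*} [NormedAddCommGroup E] [NormedSpace ℝ E]
    {h : E → ℝ} (hh : ContDiff ℝ 1 h) (x z : E) :
    ‖h x - h z‖ₑ ^ 2 ≤
      ‖x - z‖ₑ ^ 2 * ∫⁻ t in Set.Icc (0 : ℝ) 1, ‖fderiv ℝ h (z + t • (x - z))‖ₑ ^ 2 := by
  have hprob : IsProbabilityMeasure (volume.restrict (Set.Icc (0 : ℝ) 1)) :=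
    ⟨by simp⟩
  have hcont : Continuous fun t : ℝ => fderiv ℝ h (z + t • (x - z)) :=
    (hh.continuous_fderiv one_ne_zero).comp (by fun_prop)
  have hderiv : ∀ t : ℝ, HasDerivAt (fun t : ℝ => h (z + t • (x - z)))
      (fderiv ℝ h (z + t • (x - z)) (x - z)) t := fun t => by
    have h1 : HasDerivAt (fun t : ℝ => z + t • (x - z)) (x - z) t := by
      simpa using ((hasDerivAt_id t).smul_const (x - z)).const_add z
    exact ((hh.differentiable one_ne_zero) _).hasFDerivAt.comp_hasDerivAt t h1
  have hC1 : ContDiff ℝ 1 fun t : ℝ => h (z + t • (x - z)) := hh.comp (by fun_prop)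
  have hftc := enorm_sub_le_lintegral_deriv_of_contDiffOn_Icc hC1.contDiffOn
    (zero_le_one (α := ℝ))
  simp only [one_smul, zero_smul, add_zero, add_sub_cancel] at hftc
  calc ‖h x - h z‖ₑ ^ 2
      ≤ (∫⁻ t in Set.Icc (0 : ℝ) 1, ‖x - z‖ₑ * ‖fderiv ℝ h (z + t • (x - z))‖ₑ) ^ 2 := by
        gcongr
        refine hftc.trans (lintegral_mono fun t => ?_)
        rw [(hderiv t).deriv, mul_comm]
        exact ContinuousLinearMap.le_opENorm _ _
    _ ≤ ∫⁻ t in Set.Icc (0 : ℝ) 1, (‖x - z‖ₑ * ‖fderiv ℝ h (z + t • (x - z))‖ₑ) ^ 2 :=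
        sq_lintegral_le_lintegral_sq (by fun_prop)
    _ = _ := by
        simp_rw [mul_pow]
        rw [lintegral_const_mul _ (Continuous.measurable (by fun_prop))]

lemma exists_setLIntegral_sub_sq_le {N : ℕ} {h : Euc N → ℝ} (hh : ContDiff ℝ 1 h) (y : Euc N)
    {R : ℝ} (hR : 0 < R) :
    ∃ c : ℝ, ∫⁻ x in ball y R, ‖h x - c‖ₑ ^ 2 ≤
      ENNReal.ofReal (2 * R) ^ 2 * 2 ^ N * ∫⁻ x in ball y R, ‖fderiv ℝ h x‖ₑ ^ 2 := by
  set S := ball y R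
  have hSm : MeasurableSet S := measurableSet_ball
  have hcont := hh.continuous
  have hdcont := hh.continuous_fderiv one_ne_zero
  have hS0 : volume S ≠ 0 := (measure_ball_pos volume y hR).ne'
  have hStop : volume S ≠ ∞ := measure_ball_lt_top.ne
  have hdouble : ∫⁻ z in S, ∫⁻ x in S, ‖h x - h z‖ₑ ^ 2 ≤
      volume S * (ENNReal.ofReal (2 * R) ^ 2 * 2 ^ N * ∫⁻ x in S, ‖fderiv ℝ h x‖ₑ ^ 2) := by
    calc ∫⁻ z in S, ∫⁻ x in S, ‖h x - h z‖ₑ ^ 2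
        ≤ ∫⁻ z in S, ∫⁻ x in S, ENNReal.ofReal (2 * R) ^ 2 *
            ∫⁻ t in Set.Icc (0 : ℝ) 1, ‖fderiv ℝ h (z + t • (x - z))‖ₑ ^ 2 := by
          refine setLIntegral_mono' hSm fun z hz => setLIntegral_mono' hSm fun x hx => ?_
          refine (enorm_sub_sq_le_lintegral_fderiv hh x z).trans ?_
          gcongr
          rw [← ofReal_norm, ← dist_eq_norm]
          refine ENNReal.ofReal_le_ofReal ?_
          have := dist_triangle_right x z y
          have hx' : dist x y < R := hx
          have hz' : dist z y < R := hz
          linarith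
      _ = ENNReal.ofReal (2 * R) ^ 2 * ∫⁻ z in S, ∫⁻ x in S,
            ∫⁻ t in Set.Icc (0 : ℝ) 1, ‖fderiv ℝ h (z + t • (x - z))‖ₑ ^ 2 := by
          have hfin : ENNReal.ofReal (2 * R) ^ 2 ≠ ∞ := by finiteness
          simp_rw [lintegral_const_mul' _ _ hfin]
      _ = ENNReal.ofReal (2 * R) ^ 2 * ∫⁻ t in Set.Icc (0 : ℝ) 1, ∫⁻ z in S, ∫⁻ x in S,
            ‖fderiv ℝ h (z + t • (x - z))‖ₑ ^ 2 := by
          congr 1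
          have hswap : ∀ z, ∫⁻ x in S, ∫⁻ t in Set.Icc (0 : ℝ) 1,
              ‖fderiv ℝ h (z + t • (x - z))‖ₑ ^ 2 = ∫⁻ t in Set.Icc (0 : ℝ) 1, ∫⁻ x in S,
              ‖fderiv ℝ h (z + t • (x - z))‖ₑ ^ 2 := fun z =>
            lintegral_lintegral_swap (Continuous.aemeasurable (by fun_prop))
          simp_rw [hswap]
          refine lintegral_lintegral_swap (Measurable.aemeasurable ?_)
          refine Measurable.lintegral_prod_right' (f := fun q : (Euc N × ℝ) × Euc N =>
            ‖fderiv ℝ h (q.1.1 + q.1.2 • (q.2 - q.1.1))‖ₑ ^ 2) (Continuous.measurable ?_)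
          fun_prop
      _ ≤ ENNReal.ofReal (2 * R) ^ 2 * ∫⁻ t in Set.Icc (0 : ℝ) 1,
            2 ^ N * volume S * ∫⁻ x in S, ‖fderiv ℝ h x‖ₑ ^ 2 := by
          refine mul_le_mul' le_rfl (setLIntegral_mono' measurableSet_Icc fun t ht => ?_)
          exact setLIntegral_setLIntegral_segment_le (convex_ball y R) hSm
            (G := fun x => ‖fderiv ℝ h x‖ₑ ^ 2) (Continuous.measurable (by fun_prop)) ht.1 ht.2
      _ = _ := by
          rw [setLIntegral_const]
          simp only [Real.volume_Icc, sub_zero, ENNReal.ofReal_one, mul_one]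
          ring
  have hmeas : Measurable fun z => ∫⁻ x in S, ‖h x - h z‖ₑ ^ 2 :=
    Measurable.lintegral_prod_right' (f := fun q : Euc N × Euc N => ‖h q.2 - h q.1‖ₑ ^ 2)
      (by fun_prop)
  obtain ⟨z, -, hz⟩ := exists_le_setLAverage hS0 hStop (f := fun z => ∫⁻ x in S, ‖h x - h z‖ₑ ^ 2)
    hmeas.aemeasurable
  refine ⟨h z, hz.trans ?_⟩
  rw [setLAverage_eq]
  exact ENNReal.div_le_of_le_mul' hdouble

lemma exists_cutoff (N : ℕ) : ∃ K : NNReal, ∀ (y : Euc N) (ε : ℝ), 0 < ε →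
    ∃ η : Euc N → ℝ, ContDiff ℝ 1 η ∧ HasCompactSupport η ∧ tsupport η ⊆ ball y (2 * ε) ∧
      (∀ x ∈ ball y ε, η x = 1) ∧ (∀ x, |η x| ≤ 1) ∧ ∀ x, ‖fderiv ℝ η x‖ ≤ K * ε⁻¹ := by
  let f : ContDiffBump (0 : Euc N) := ⟨1, 3 / 2, by norm_num, by norm_num⟩
  have hf : ContDiff ℝ 1 f := f.contDiff
  obtain ⟨K, hK⟩ := (hf.continuous_fderiv one_ne_zero).bounded_above_of_compact_support
    (f.hasCompactSupport.fderiv ℝ)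
  refine ⟨⟨max K 0, le_max_right _ _⟩, fun y ε hε => ?_⟩
  have hsub : tsupport (fun x => f (ε⁻¹ • (x - y))) ⊆ closedBall y (3 / 2 * ε) := by
    refine closure_minimal (fun x hx => ?_) isClosed_closedBall
    have hx' : ε⁻¹ • (x - y) ∈ Function.support f := hx
    rw [f.support_eq, mem_ball_zero_iff, norm_smul, norm_inv, Real.norm_of_nonneg hε.le,
      inv_mul_lt_iff₀ hε] at hx'
    rw [mem_closedBall, dist_eq_norm]
    change ‖x - y‖ < ε * (3 / 2) at hx'
    linarith
  refine ⟨fun x => f (ε⁻¹ • (x - y)), hf.comp (by fun_prop),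
    HasCompactSupport.of_support_subset_isCompact (isCompact_closedBall y (3 / 2 * ε))
      ((subset_tsupport _).trans hsub), hsub.trans (closedBall_subset_ball (by linarith)),
    fun x hx => f.one_of_mem_closedBall ?_, fun x => ?_, fun x => ?_⟩
  · rw [mem_closedBall_zero_iff, norm_smul, norm_inv, Real.norm_of_nonneg hε.le,
      inv_mul_le_iff₀ hε, ← dist_eq_norm]
    change dist x y ≤ ε * 1
    linarith [mem_ball.1 hx]
  · rw [abs_of_nonneg f.nonneg]
    exact f.le_one
  · have hd : HasFDerivAt (fun x => f (ε⁻¹ • (x - y)))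
        ((fderiv ℝ f (ε⁻¹ • (x - y))).comp (ε⁻¹ • ContinuousLinearMap.id ℝ (Euc N))) x :=
      ((hf.differentiable one_ne_zero) _).hasFDerivAt.comp x
        (((hasFDerivAt_id x).sub_const y).const_smul ε⁻¹)
    rw [hd.fderiv, ContinuousLinearMap.comp_smul, ContinuousLinearMap.comp_id, norm_smul,
      norm_inv, Real.norm_of_nonneg hε.le, mul_comm]
    gcongr
    exact (hK _).trans (le_max_left _ _)

lemma eLpNorm_two_eq_lintegral {α F : Type*} [MeasurableSpace α] [NormedAddCommGroup F]
    (f : α → F) (μ : Measure α) :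
    eLpNorm f 2 μ = (∫⁻ x, ‖f x‖ₑ ^ 2 ∂μ) ^ ((1 : ℝ) / 2) := by
  simp [eLpNorm_eq_lintegral_rpow_enorm_toReal]

lemma exists_sobolev_ball_const (N : ℕ) (hN : 2 < N) {s : NNReal}
    (hs : (s : ℝ)⁻¹ = 2⁻¹ - (N : ℝ)⁻¹) :
    ∃ C : ℝ≥0∞, C ≠ ∞ ∧ ∀ h : Euc N → ℝ, ContDiff ℝ 1 h → ∀ (y : Euc N) (ε : ℝ), 0 < ε →
      ∃ c : ℝ, eLpNorm (fun x => h x - c) s (volume.restrict (ball y ε)) ≤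
        C * eLpNorm (fderiv ℝ h) 2 (volume.restrict (ball y (2 * ε))) := by
  obtain ⟨K, hK⟩ := exists_cutoff N
  set A : ℝ≥0∞ := ↑(SNormLESNormFDerivOfEqConst ℝ (volume : Measure (Euc N)) ((2 : NNReal) : ℝ))
  refine ⟨A * (1 + K * (4 * (2 ^ N) ^ ((1 : ℝ) / 2))), ?_, fun h hh y ε hε => ?_⟩
  · finiteness
  obtain ⟨c, hc⟩ := exists_setLIntegral_sub_sq_le hh y (R := 2 * ε) (by positivity)
  obtain ⟨η, hη, hηc, hηs, hη1, hηle, hηd⟩ := hK y ε hε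
  refine ⟨c, ?_⟩
  set S := ball y (2 * ε)
  set v : Euc N → ℝ := fun x => η x * (h x - c)
  have hv : ContDiff ℝ 1 v := hη.mul (hh.sub contDiff_const)
  have hvc : HasCompactSupport v := hηc.mul_right
  have hpoinc : eLpNorm (fun x => h x - c) 2 (volume.restrict S) ≤
      ENNReal.ofReal ε * (4 * (2 ^ N) ^ ((1 : ℝ) / 2)) *
        eLpNorm (fderiv ℝ h) 2 (volume.restrict S) := by
    rw [eLpNorm_two_eq_lintegral, eLpNorm_two_eq_lintegral]
    refine (ENNReal.rpow_le_rpow hc (by norm_num)).trans_eq ?_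
    rw [ENNReal.mul_rpow_of_nonneg _ _ (by norm_num), ENNReal.mul_rpow_of_nonneg _ _ (by norm_num),
      ← ENNReal.rpow_two, ← ENNReal.rpow_mul]
    have h4 : ENNReal.ofReal (2 * (2 * ε)) = 4 * ENNReal.ofReal ε := by
      rw [← mul_assoc, ENNReal.ofReal_mul (by norm_num)]; norm_num
    rw [h4]
    norm_num
    ring
  have hdv : ∀ x, ‖fderiv ℝ v x‖ ≤ ‖‖fderiv ℝ h x‖ + K * ε⁻¹ * ‖h x - c‖‖ := fun x => by
    have hd : HasFDerivAt v (η x • fderiv ℝ h x + (h x - c) • fderiv ℝ η x) x :=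
      ((hη.differentiable one_ne_zero) x).hasFDerivAt.mul
        (((hh.differentiable one_ne_zero) x).hasFDerivAt.sub_const c)
    rw [hd.fderiv, Real.norm_of_nonneg (by positivity)]
    refine (norm_add_le _ _).trans (add_le_add ?_ ?_)
    · rw [norm_smul, Real.norm_eq_abs]
      exact mul_le_of_le_one_left (norm_nonneg _) (hηle x)
    · rw [norm_smul, mul_comm]
      gcongr
      exact hηd x
  have hsupp : Function.support (fderiv ℝ v) ⊆ S :=
    (support_fderiv_subset ℝ).trans ((closure_mono (Function.support_mul_subset_left _ _)).trans
      hηs)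
  have hKε : ‖(K : ℝ) * ε⁻¹‖ₑ * ENNReal.ofReal ε = K := by
    rw [← ofReal_norm, ← ENNReal.ofReal_mul (norm_nonneg _), Real.norm_of_nonneg (by positivity),
      mul_assoc, inv_mul_cancel₀ hε.ne', mul_one, ENNReal.ofReal_coe_nnreal]
  have hdcont := hh.continuous_fderiv one_ne_zero
  have hcont := hh.continuous
  calc eLpNorm (fun x => h x - c) s (volume.restrict (ball y ε))
      ≤ eLpNorm v s (volume.restrict (ball y ε)) := by
        refine eLpNorm_mono_ae ?_
        filter_upwards [self_mem_ae_restrict measurableSet_ball] with x hx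
        simp [v, hη1 x hx]
    _ ≤ eLpNorm v s volume := eLpNorm_mono_measure _ Measure.restrict_le_self
    _ ≤ A * eLpNorm (fderiv ℝ v) (2 : NNReal) volume :=
        eLpNorm_le_eLpNorm_fderiv_of_eq volume hv hvc (by norm_num) (by simp; omega)
          (by simpa using hs)
    _ = A * eLpNorm (fderiv ℝ v) 2 (volume.restrict S) := by
        rw [eLpNorm_restrict_eq_of_support_subset (f := fderiv ℝ v) hsupp]; rfl
    _ ≤ A * eLpNorm (fun x => ‖fderiv ℝ h x‖ + K * ε⁻¹ * ‖h x - c‖) 2 (volume.restrict S) := by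
        gcongr
        exact eLpNorm_mono hdv
    _ ≤ A * (eLpNorm (fun x => ‖fderiv ℝ h x‖) 2 (volume.restrict S) +
          eLpNorm (fun x => K * ε⁻¹ * ‖h x - c‖) 2 (volume.restrict S)) := by
        gcongr
        exact eLpNorm_add_le (Continuous.aestronglyMeasurable (by fun_prop))
          (Continuous.aestronglyMeasurable (by fun_prop)) (by norm_num)
    _ ≤ A * (eLpNorm (fderiv ℝ h) 2 (volume.restrict S) +
          ‖(K : ℝ) * ε⁻¹‖ₑ * (ENNReal.ofReal ε * (4 * (2 ^ N) ^ ((1 : ℝ) / 2)) *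
            eLpNorm (fderiv ℝ h) 2 (volume.restrict S))) := by
        rw [eLpNorm_norm]
        gcongr
        refine (eLpNorm_const_smul_le (c := (K : ℝ) * ε⁻¹) (f := fun x => ‖h x - c‖)).trans ?_
        rw [eLpNorm_norm]
        gcongr
    _ = _ := by
        rw [← mul_assoc, ← mul_assoc, hKε]
        ring

lemma eLpNorm_sub_average_le {α : Type*} [MeasurableSpace α] {μ : Measure α} [IsFiniteMeasure μ]
    {h : α → ℝ} (hint : Integrable h μ) {s : ℝ≥0∞} (hs : 1 ≤ s) (c : ℝ) :
    eLpNorm (fun x => h x - ⨍ z, h z ∂μ) s μ ≤ 2 * eLpNorm (fun x => h x - c) s μ := by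
  rcases eq_or_ne μ 0 with rfl | hμ
  · simp
  have : NeZero μ := ⟨hμ⟩
  have hs0 : s ≠ 0 := (zero_lt_one.trans_le hs).ne'
  have hμ0 : μ Set.univ ≠ 0 := by simpa using hμ
  have hμt : μ Set.univ ≠ ∞ := measure_ne_top _ _
  have hm : AEStronglyMeasurable (fun x => h x - c) μ :=
    hint.aestronglyMeasurable.sub aestronglyMeasurable_const
  set a := ⨍ z, h z ∂μ
  have hac : ‖c - a‖ₑ * μ Set.univ ≤ eLpNorm (fun x => h x - c) 1 μ := by
    have hc : a - c = ⨍ z, (h z - c) ∂μ := by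
      rw [average_eq, integral_sub hint (integrable_const c), smul_sub, ← average_eq, ← average_eq,
        average_const]
    rw [← enorm_neg, neg_sub, hc, average_eq, enorm_smul, eLpNorm_one_eq_lintegral_enorm]
    have hinv : ‖(μ.real Set.univ)⁻¹‖ₑ * μ Set.univ = 1 := by
      rw [← ofReal_norm, Real.norm_of_nonneg (by positivity), Measure.real,
        ← ENNReal.toReal_inv, ENNReal.ofReal_toReal (by simpa using hμ),
        ENNReal.inv_mul_cancel hμ0 hμt]
    rw [mul_right_comm, hinv, one_mul]
    exact enorm_integral_le_lintegral_enorm _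
  have hconst : eLpNorm (fun _ : α => c - a) s μ ≤ eLpNorm (fun x => h x - c) s μ := by
    rw [eLpNorm_const _ hs0 hμ]
    have h1 := eLpNorm_le_eLpNorm_mul_rpow_measure_univ hs hm
    refine (ENNReal.mul_le_mul_iff_left (c := μ Set.univ ^ (1 - 1 / s.toReal)) ?_ ?_).1 ?_
    · simp [ENNReal.rpow_eq_zero_iff, hμ, hμt]
    · simp [ENNReal.rpow_eq_top_iff, hμ, hμt]
    · rw [mul_assoc, ← ENNReal.rpow_add _ _ hμ0 hμt]
      simpa using hac.trans h1
  calc eLpNorm (fun x => h x - a) s μ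
      = eLpNorm ((fun x => h x - c) + fun _ => c - a) s μ := by
        congr 1; ext x; simp
    _ ≤ eLpNorm (fun x => h x - c) s μ + eLpNorm (fun _ : α => c - a) s μ :=
        eLpNorm_add_le hm aestronglyMeasurable_const hs
    _ ≤ 2 * eLpNorm (fun x => h x - c) s μ := by
        rw [two_mul]; gcongr

lemma hasDerivAt_abs_rpow_mul_self {p : ℝ} (hp : 1 ≤ p) (t : ℝ) :
    HasDerivAt (fun t : ℝ => |t| ^ (p - 1) * t) (p * |t| ^ (p - 1)) t := by
  rcases hp.eq_or_lt with rfl | hp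
  · simpa using hasDerivAt_id' t
  have hpow : ∀ x : ℝ, 0 < x → x ^ (p - 1) * x = x ^ p := fun x hx => by
    rw [← Real.rpow_add_one hx.ne', sub_add_cancel]
  rcases lt_trichotomy t 0 with ht | rfl | ht
  · have hd := ((hasDerivAt_neg t).rpow_const (p := p) (Or.inr hp.le)).neg
    rw [abs_of_neg ht]
    refine (hd.congr_of_eventuallyEq ?_).congr_deriv (by ring)
    filter_upwards [Iio_mem_nhds ht] with x hx
    have hx' : x < 0 := hx
    simp only [Pi.neg_apply]
    rw [abs_of_neg hx', ← hpow (-x) (neg_pos.2 hx')]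
    ring
  · have hlim : Filter.Tendsto (fun x : ℝ => |x| ^ (p - 1)) (𝓝[≠] 0) (𝓝 0) := by
      have hc : Continuous fun x : ℝ => |x| ^ (p - 1) :=
        continuous_abs.rpow_const fun _ => Or.inr (by linarith)
      have := hc.tendsto 0
      rw [abs_zero, Real.zero_rpow (by linarith)] at this
      exact this.mono_left nhdsWithin_le_nhds
    rw [hasDerivAt_iff_tendsto_slope, abs_zero, Real.zero_rpow (by linarith), mul_zero]
    refine hlim.congr' ?_
    filter_upwards [self_mem_nhdsWithin] with x hx
    have hx' : x ≠ 0 := hx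
    simp [slope_def_field, hx']
  · have hd := Real.hasDerivAt_rpow_const (x := t) (p := p) (Or.inl ht.ne')
    rw [abs_of_pos ht]
    refine hd.congr_of_eventuallyEq ?_
    filter_upwards [Ioi_mem_nhds ht] with x hx
    rw [abs_of_pos hx, hpow x hx]

lemma contDiff_abs_rpow_mul_self {p : ℝ} (hp : 1 ≤ p) :
    ContDiff ℝ 1 fun t : ℝ => |t| ^ (p - 1) * t := by
  rw [contDiff_one_iff_deriv]
  refine ⟨fun t => (hasDerivAt_abs_rpow_mul_self hp t).differentiableAt, ?_⟩
  rw [funext fun t => (hasDerivAt_abs_rpow_mul_self hp t).deriv]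
  exact continuous_const.mul (continuous_abs.rpow_const fun _ => Or.inr (by linarith))

lemma abs_abs_rpow_mul_self {p : ℝ} (hp : 1 ≤ p) (t : ℝ) :
    |(|t| ^ (p - 1) * t)| = |t| ^ p := by
  rw [abs_mul, abs_of_nonneg (by positivity)]
  rcases eq_or_ne t 0 with rfl | ht
  · simp [Real.zero_rpow (by linarith : p ≠ 0)]
  · rw [← Real.rpow_add_one (abs_ne_zero.2 ht), sub_add_cancel]

lemma norm_gradient {E : Type*} [NormedAddCommGroup E] [InnerProductSpace ℝ E] [CompleteSpace E]
    (f : E → ℝ) (x : E) : ‖gradient f x‖ = ‖fderiv ℝ f x‖ := by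
  rw [← toDual_gradient, LinearIsometryEquiv.norm_map]

lemma enorm_fderiv_abs_rpow_mul_self_sq {N : ℕ} {p : ℝ} (hp : 1 ≤ p) {H : Euc N → ℝ}
    (hH : ContDiff ℝ 1 H) (x : Euc N) :
    ‖fderiv ℝ (fun x => |H x| ^ (p - 1) * H x) x‖ₑ ^ 2 =
      ENNReal.ofReal p ^ 2 *
        ENNReal.ofReal |(|H x| ^ (2 * (p - 1)) * ‖gradient H x‖ ^ 2)| := by
  have hd := (hasDerivAt_abs_rpow_mul_self hp (H x)).comp_hasFDerivAt x
    ((hH.differentiable one_ne_zero) x).hasFDerivAt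
  have hf : fderiv ℝ (fun x => |H x| ^ (p - 1) * H x) x =
      (p * |H x| ^ (p - 1)) • fderiv ℝ H x := hd.fderiv
  have hnn : 0 ≤ |H x| ^ (2 * (p - 1)) * ‖gradient H x‖ ^ 2 := by positivity
  rw [hf, abs_of_nonneg hnn, ← ENNReal.ofReal_pow (by linarith),
    ← ENNReal.ofReal_mul (by positivity), ← ofReal_norm, ← ENNReal.ofReal_pow (norm_nonneg _),
    norm_smul, Real.norm_of_nonneg (by positivity), norm_gradient, mul_comm 2 (p - 1),
    Real.rpow_mul (abs_nonneg _), Real.rpow_two]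
  congr 1
  ring

lemma setLIntegral_ball_le_maxFn_mul {N : ℕ} (F : Euc N → ℝ) (y : Euc N) {r : ℝ} (hr : 0 < r) :
    ∫⁻ x in ball y r, ENNReal.ofReal |F x| ≤ maxFn F y * volume (ball y r) := by
  have h0 : volume (ball y r) ≠ 0 := (measure_ball_pos volume y hr).ne'
  have hle : (∫⁻ x in ball y r, ENNReal.ofReal |F x|) / volume (ball y r) ≤ maxFn F y :=
    le_iSup₂ (f := fun (ε : ℝ) (_ : 0 < ε) =>
      (∫⁻ x in ball y ε, ENNReal.ofReal |F x|) / volume (ball y ε)) r hr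
  exact (ENNReal.div_le_iff h0 measure_ball_lt_top.ne).1 hle

lemma ofReal_rpow_mul_volume_ball_rpow {N : ℕ} {q : ℝ} (hN : N ≠ 0)
    (hq : 1 / q = 1 / 2 + 1 / (N : ℝ)) (y : Euc N) {ε : ℝ} (hε : 0 < ε) :
    ENNReal.ofReal (ε ^ (-(N : ℝ) - 1)) * volume (ball y (2 * ε)) ^ ((1 : ℝ) / 2) *
        volume (ball y ε) ^ (1 / q) =
      (2 ^ N * volume (ball (0 : Euc N) 1)) ^ ((1 : ℝ) / 2) *
        volume (ball (0 : Euc N) 1) ^ (1 / q) := by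
  have hN' : (N : ℝ) ≠ 0 := by exact_mod_cast hN
  have hq0 : 0 ≤ 1 / q := by rw [hq]; positivity
  have he0 : ENNReal.ofReal ε ≠ 0 := by simpa using hε
  have he1 : ENNReal.ofReal ε ≠ ∞ := ENNReal.ofReal_ne_top
  have hball : ∀ r : ℝ, 0 < r → volume (ball y r) =
      ENNReal.ofReal r ^ (N : ℝ) * volume (ball (0 : Euc N) 1) := fun r hr => by
    rw [Measure.addHaar_ball_of_pos _ _ hr, finrank_euclideanSpace_fin,
      ENNReal.ofReal_pow hr.le, ENNReal.rpow_natCast]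
  have hpow : ENNReal.ofReal ε ^ (-(N : ℝ) - 1) * ENNReal.ofReal ε ^ ((N : ℝ) * (1 / 2)) *
      ENNReal.ofReal ε ^ ((N : ℝ) * (1 / q)) = 1 := by
    rw [← ENNReal.rpow_add _ _ he0 he1, ← ENNReal.rpow_add _ _ he0 he1, hq]
    have : -(N : ℝ) - 1 + N * (1 / 2) + N * (1 / 2 + 1 / N) = 0 := by field_simp; ring
    rw [this, ENNReal.rpow_zero]
  rw [hball _ hε, hball _ (by positivity), ENNReal.ofReal_mul (by norm_num),
    ← ENNReal.ofReal_rpow_of_pos hε, ENNReal.mul_rpow_of_nonneg _ _ (by norm_num),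
    ENNReal.mul_rpow_of_nonneg _ _ (by positivity), ENNReal.mul_rpow_of_nonneg _ _ (by norm_num),
    ENNReal.mul_rpow_of_nonneg _ _ hq0, ENNReal.mul_rpow_of_nonneg _ _ (by norm_num),
    ← ENNReal.rpow_natCast 2 N, ← ENNReal.rpow_mul, ← ENNReal.rpow_mul, ← ENNReal.rpow_mul,
    ENNReal.ofReal_ofNat]
  calc _ = (ENNReal.ofReal ε ^ (-(N : ℝ) - 1) * ENNReal.ofReal ε ^ ((N : ℝ) * (1 / 2)) *
        ENNReal.ofReal ε ^ ((N : ℝ) * (1 / q))) * (2 ^ ((N : ℝ) * (1 / 2)) *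
          volume (ball (0 : Euc N) 1) ^ ((1 : ℝ) / 2) *
          volume (ball (0 : Euc N) 1) ^ (1 / q)) := by ring
    _ = _ := by rw [hpow, one_mul, ENNReal.rpow_mul]

theorem stmt_6 (N : ℕ) (hN : 2 < N) (p : ℝ) (hp : 1 ≤ p) :
    ∃ C : ℝ≥0∞, C ≠ ⊤ ∧
      ∀ (φ : Euc N → ℝ), ContDiff ℝ (⊤ : ℕ∞) φ → (∀ x, 0 ≤ φ x) →
        Function.support φ ⊆ ball 0 1 → (∫ x, φ x ∂volume) = 1 →
        (∀ ε : ℝ, 0 < ε → ∀ x, molli φ ε x ≤ ε ^ (-(N : ℝ))) →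
        (∀ ε : ℝ, 0 < ε → ∀ x, ‖gradient (molli φ ε) x‖ ≤ ε ^ (-(N : ℝ) - 1)) →
      ∀ (u H : Euc N → ℝ), ContDiff ℝ 1 u → ContDiff ℝ 1 H →
      ∀ y : Euc N,
        (⨆ (ε : ℝ) (_ : 0 < ε),
          ∫⁻ x in ball y ε, ENNReal.ofReal
            (‖gradient (molli φ ε) (x - y)‖ *
              |(|H x| ^ (p-1) * H x) -
                ⨍ z in ball y ε, (|H z| ^ (p-1) * H z) ∂volume| *
              |(|H x| ^ (p-1) * H x)| * ‖gradient u x‖) ∂volume) ≤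
          C * (maxFn (fun x => |H x| ^ (2*(p-1)) * ‖gradient H x‖^2) y) ^ ((1:ℝ)/2) *
            (maxFn (fun x => (|H x| ^ p * ‖gradient u x‖) ^ (2*N/(N+2) : ℝ)) y)
              ^ (1 / (2*N/(N+2) : ℝ)) := by
  have hN' : (2 : ℝ) < N := by exact_mod_cast hN
  set q : ℝ := 2 * N / (N + 2)
  have hq : 1 / q = 1 / 2 + 1 / (N : ℝ) := by simp only [q]; field_simp
  have hq0 : 0 < q := by positivity
  have hs0 : (0 : ℝ) < 2 * N / (N - 2) := div_pos (by linarith) (by linarith)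
  let s : NNReal := ⟨2 * N / (N - 2), hs0.le⟩
  have hs : (s : ℝ)⁻¹ = 2⁻¹ - (N : ℝ)⁻¹ := by
    change (2 * (N : ℝ) / (N - 2))⁻¹ = _
    field_simp
  have hsq : (s : ℝ).HolderConjugate q := by
    refine ⟨?_, hs0, hq0⟩
    rw [hs, inv_one, ← one_div q, hq]
    ring
  have hs1 : (1 : ℝ≥0∞) ≤ s := by exact_mod_cast hsq.lt.le
  obtain ⟨C, hC, hsob⟩ := exists_sobolev_ball_const N hN hs
  have hω : volume (ball (0 : Euc N) 1) ≠ ∞ := measure_ball_lt_top.ne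
  refine ⟨2 * C * ENNReal.ofReal p * ((2 ^ N * volume (ball (0 : Euc N) 1)) ^ ((1 : ℝ) / 2) *
    volume (ball (0 : Euc N) 1) ^ (1 / q)), ?_, ?_⟩
  · have : 0 ≤ 1 / q := by positivity
    finiteness
  intro φ _ _ _ _ _ hφ u H hu hH y
  refine iSup₂_le fun ε hε => ?_
  set Φ := fun x => |H x| ^ (2 * (p - 1)) * ‖gradient H x‖ ^ 2
  set Ψ := fun x => (|H x| ^ p * ‖gradient u x‖) ^ q
  set h : Euc N → ℝ := fun x => |H x| ^ (p - 1) * H x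
  have hh : ContDiff ℝ 1 h := (contDiff_abs_rpow_mul_self hp).comp hH
  have hcont := hh.continuous
  have hfin : IsFiniteMeasure (volume.restrict (ball y ε)) :=
    ⟨by simpa using measure_ball_lt_top⟩
  have hint : IntegrableOn h (ball y ε) :=
    (hcont.continuousOn.integrableOn_compact (isCompact_closedBall y ε)).mono_set
      ball_subset_closedBall
  set a := ⨍ z in ball y ε, h z
  have hosc : (∫⁻ x in ball y ε, ‖h x - a‖ₑ ^ (s : ℝ)) ^ (1 / (s : ℝ)) ≤
      2 * C * ENNReal.ofReal p *
        (maxFn Φ y ^ ((1 : ℝ) / 2) * volume (ball y (2 * ε)) ^ ((1 : ℝ) / 2)) := by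
    obtain ⟨c, hc⟩ := hsob h hh y ε hε
    have hmean := (eLpNorm_sub_average_le hint hs1 c).trans (mul_le_mul' le_rfl hc)
    rw [eLpNorm_eq_lintegral_rpow_enorm_toReal (by positivity) ENNReal.coe_ne_top,
      eLpNorm_two_eq_lintegral] at hmean
    refine hmean.trans ?_
    rw [← mul_assoc, mul_assoc (2 * C)]
    gcongr
    simp_rw [h, enorm_fderiv_abs_rpow_mul_self_sq hp hH]
    rw [lintegral_const_mul' _ _ (by finiteness), ENNReal.mul_rpow_of_nonneg _ _ (by norm_num),
      ← ENNReal.rpow_two, ← ENNReal.rpow_mul, ← ENNReal.mul_rpow_of_nonneg _ _ (by norm_num)]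
    norm_num only [mul_one_div_cancel, ENNReal.rpow_one]
    gcongr
    exact setLIntegral_ball_le_maxFn_mul Φ y (by positivity)
  have hgrad : (∫⁻ x in ball y ε, ENNReal.ofReal (|H x| ^ p * ‖gradient u x‖) ^ q) ^ (1 / q) ≤
      maxFn Ψ y ^ (1 / q) * volume (ball y ε) ^ (1 / q) := by
    rw [← ENNReal.mul_rpow_of_nonneg _ _ (by positivity)]
    gcongr
    refine le_trans (lintegral_mono fun x => ?_) (setLIntegral_ball_le_maxFn_mul Ψ y hε)
    have hnn : 0 ≤ |H x| ^ p * ‖gradient u x‖ := by positivity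
    rw [ENNReal.ofReal_rpow_of_nonneg hnn hq0.le]
    exact ENNReal.ofReal_le_ofReal (le_abs_self _)
  have hmeas : Measurable fun x => ENNReal.ofReal (|H x| ^ p * ‖gradient u x‖) := by
    simp_rw [norm_gradient]
    refine (Continuous.mul ?_ (hu.continuous_fderiv one_ne_zero).norm).measurable.ennreal_ofReal
    exact hH.continuous.abs.rpow_const fun _ => Or.inr (by linarith)
  calc ∫⁻ x in ball y ε, ENNReal.ofReal
        (‖gradient (molli φ ε) (x - y)‖ * |h x - a| * |h x| * ‖gradient u x‖)
      ≤ ∫⁻ x in ball y ε, ENNReal.ofReal (ε ^ (-(N : ℝ) - 1)) *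
          (‖h x - a‖ₑ * ENNReal.ofReal (|H x| ^ p * ‖gradient u x‖)) := by
        refine lintegral_mono fun x => ?_
        rw [← ofReal_norm, ← ENNReal.ofReal_mul (norm_nonneg _),
          ← ENNReal.ofReal_mul (by positivity), abs_abs_rpow_mul_self hp, Real.norm_eq_abs]
        refine ENNReal.ofReal_le_ofReal ?_
        rw [mul_assoc, mul_assoc]
        exact mul_le_mul_of_nonneg_right (hφ ε hε _) (by positivity)
    _ = ENNReal.ofReal (ε ^ (-(N : ℝ) - 1)) * ∫⁻ x in ball y ε,
          ‖h x - a‖ₑ * ENNReal.ofReal (|H x| ^ p * ‖gradient u x‖) :=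
        lintegral_const_mul' _ _ ENNReal.ofReal_ne_top
    _ ≤ ENNReal.ofReal (ε ^ (-(N : ℝ) - 1)) *
          ((2 * C * ENNReal.ofReal p *
            (maxFn Φ y ^ ((1 : ℝ) / 2) * volume (ball y (2 * ε)) ^ ((1 : ℝ) / 2))) *
          (maxFn Ψ y ^ (1 / q) * volume (ball y ε) ^ (1 / q))) := by
        refine mul_le_mul' le_rfl (le_trans ?_ (mul_le_mul' hosc hgrad))
        exact ENNReal.lintegral_mul_le_Lp_mul_Lq _ hsq
          (Continuous.aemeasurable (by fun_prop)) hmeas.aemeasurable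
    _ = 2 * C * ENNReal.ofReal p * (ENNReal.ofReal (ε ^ (-(N : ℝ) - 1)) *
          volume (ball y (2 * ε)) ^ ((1 : ℝ) / 2) * volume (ball y ε) ^ (1 / q)) *
          maxFn Φ y ^ ((1 : ℝ) / 2) * maxFn Ψ y ^ (1 / q) := by ring
    _ = _ := by rw [ofReal_rpow_mul_volume_ball_rpow (by omega) hq y hε]
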